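/- Let G=(V,E) be a finite multigraph with a partition {B,R} of V, d≥3 an integer, D=binom(d+1,2), and f(F)=D(|V(F)|−1)−|R(F)|. Then: (i) every nontrivial M-connected component X of the count matroid M_f(f∘G,{B,R}) equals f∘F for some nontrivial P-connected component F of the polymatroid PM_f(G,{B,R}); (ii) if F⊆E is a nontrivial P-connected set in PM_f(G,{B,R}), then f∘F is M-connected in M_f(f∘G,{B,R}); (iii) if {C_1,…,C_k} is the partition of E into P-connected components of PM_f(G,{B,R}), then f̂(E) = Σ_{i=1}^k f(C_i), i.e., this partition attains the minimum in the definition of f̂(E). -/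

import Mathlib

/- STATEMENT 16: (i) nontrivial M-connected components of `M_f(f∘G)` are of the form `f∘F`
for nontrivial P-connected components `F` of `PM_f(G)`; (ii) `f∘F` is M-connected for any
nontrivial P-connected `F`; (iii) the P-connected component decomposition attains the
minimum defining `f̂(E)`. -/

set_option synthInstance.maxHeartbeats 1000000
set_option maxHeartbeats 1000000

open scoped Classical

noncomputable section

/-- The set `V(F)` of vertices spanned by an edge set `F` in a multigraph whose edges `e : ε`
have endpoint pairs `π e : Sym2 V`. -/
def VF {V ε : Type} [Fintype V] (π : ε → Sym2 V) (F : Finset ε) : Finset V :=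
  Finset.univ.filter (fun v => ∃ e ∈ F, v ∈ π e)

/-- The count function `f(F) = D·|V(F)| − D − |R(F)|`. -/
def fCnt {V ε : Type} [Fintype V] (D : ℕ) (π : ε → Sym2 V) (R : Finset V)
    (F : Finset ε) : ℤ :=
  (D : ℤ) * (VF π F).card - D - ((VF π F) ∩ R).card

/-- Independence in the count matroid `M_f`: `|F'| ≤ f(F')` for all nonempty `F' ⊆ F`. -/
def CIndep {V ε : Type} [Fintype V] (D : ℕ) (π : ε → Sym2 V) (R : Finset V)
    (F : Finset ε) : Prop :=
  ∀ F' ⊆ F, F'.Nonempty → (F'.card : ℤ) ≤ fCnt D π R F'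

/-- The rank function of the count matroid `M_f`: the maximum size of an independent subset. -/
def cRank {V ε : Type} [Fintype V] (D : ℕ) (π : ε → Sym2 V) (R : Finset V)
    (F : Finset ε) : ℕ :=
  sSup {n : ℕ | ∃ F' ⊆ F, CIndep D π R F' ∧ F'.card = n}

/-- A circuit of the count matroid: a minimal dependent set. -/
def CCircuit {V ε : Type} [Fintype V] (D : ℕ) (π : ε → Sym2 V) (R : Finset V)
    (C : Finset ε) : Prop :=
  ¬ CIndep D π R C ∧ ∀ C' ⊂ C, CIndep D π R C'

/-- `F` is M-connected: every pair of its elements lies on a common circuit contained in `F`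
(singletons and the empty set count as M-connected). -/
def MConn {V ε : Type} [Fintype V] (D : ℕ) (π : ε → Sym2 V) (R : Finset V)
    (F : Finset ε) : Prop :=
  F.card ≤ 1 ∨ ∀ e ∈ F, ∀ e' ∈ F, ∃ C ⊆ F, CCircuit D π R C ∧ e ∈ C ∧ e' ∈ C

/-- `X` is an M-connected component of the count matroid restricted to the ground set `G`:
a maximal M-connected subset of `G`. -/
def MConnComp {V ε : Type} [Fintype V] (D : ℕ) (π : ε → Sym2 V) (R : Finset V)
    (G X : Finset ε) : Prop :=
  X ⊆ G ∧ MConn D π R X ∧ ∀ Y ⊆ G, MConn D π R Y → X ⊆ Y → Y = X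

/-- `P` is a partition of `F` into nonempty parts. -/
def IsPartitionOf {ε : Type} [DecidableEq ε] (F : Finset ε) (P : Finset (Finset ε)) : Prop :=
  (∀ p ∈ P, p.Nonempty) ∧ (P : Set (Finset ε)).PairwiseDisjoint id ∧ P.biUnion id = F

/-- The induced polymatroid function `f̂(F) = min Σᵢ f(Fᵢ)` over partitions of `F` into
nonempty parts (with `f̂(∅) = 0`). -/
def fHat {V ε : Type} [Fintype V] [DecidableEq ε] (D : ℕ) (π : ε → Sym2 V) (R : Finset V)
    (F : Finset ε) : ℤ :=
  sInf {s : ℤ | ∃ P : Finset (Finset ε), IsPartitionOf F P ∧ s = ∑ p ∈ P, fCnt D π R p}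

/-- `F` is P-connected in the polymatroid `(E, f̂)`: no partition of `F` into at least two
nonempty parts satisfies `f̂(F) = Σᵢ f̂(Fᵢ)`. -/
def PConn {V ε : Type} [Fintype V] [DecidableEq ε] (D : ℕ) (π : ε → Sym2 V) (R : Finset V)
    (F : Finset ε) : Prop :=
  F.Nonempty ∧ ∀ P : Finset (Finset ε), IsPartitionOf F P → 2 ≤ P.card →
    fHat D π R F ≠ ∑ p ∈ P, fHat D π R p

/-- `C` is a P-connected component of the polymatroid on the ground set `G`: a maximal
P-connected subset of `G`. -/
def PConnComp {V ε : Type} [Fintype V] [DecidableEq ε] (D : ℕ) (π : ε → Sym2 V) (R : Finset V)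
    (G C : Finset ε) : Prop :=
  C ⊆ G ∧ PConn D π R C ∧ ∀ C' ⊆ G, PConn D π R C' → C ⊆ C' → C' = C

/-- The multiplicity `f({e}) = D − |R({e})|` of an edge in `f∘G`. -/
def fMult {V ε : Type} [Fintype V] (D : ℕ) (π : ε → Sym2 V) (R : Finset V) (e : ε) : ℕ :=
  D - ((VF π ({e} : Finset ε)) ∩ R).card

/-- The set `f∘F` of all copies of edges of `F` in `f∘G`; copies of `e` are indexed by
`i : Fin D` with `i < f({e})`. -/
def fCopy {V ε : Type} [Fintype V] [DecidableEq ε] (D : ℕ) (π : ε → Sym2 V) (R : Finset V)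
    (F : Finset ε) : Finset (ε × Fin D) :=
  F.biUnion (fun e =>
    ({e} : Finset ε) ×ˢ (Finset.univ.filter (fun i : Fin D => (i : ℕ) < fMult D π R e)))

end


set_option linter.unusedSectionVars false
set_option linter.unusedVariables false

section AbstractCount

variable {α : Type} [DecidableEq α]

def AInd (g : Finset α → ℤ) (I : Finset α) : Prop :=
  ∀ S ⊆ I, S.Nonempty → (S.card : ℤ) ≤ g S

def ATight (g : Finset α → ℤ) (I : Finset α) : Finset (Finset α) :=
  I.powerset.filter (fun T => T.Nonempty ∧ g T ≤ T.card ∧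
    ∀ S ⊆ I, g S ≤ S.card → T ⊆ S → S = T)

structure AGood (g : Finset α → ℤ) : Prop where
  mono : ∀ S T, S ⊆ T → g S ≤ g T
  sub : ∀ S T, g (S ∪ T) + g (S ∩ T) ≤ g S + g T
  pos : ∀ x, 1 ≤ g {x}

variable {g : Finset α → ℤ}

theorem AInd.subset {I J : Finset α} (h : AInd g J) (hIJ : I ⊆ J) : AInd g I :=
  fun S hS hn => h S (hS.trans hIJ) hn

theorem ATight_exists {I S : Finset α} (hS : S ⊆ I) (hn : S.Nonempty)
    (ht : g S ≤ S.card) : ∃ T ∈ ATight g I, S ⊆ T := by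
  obtain ⟨T, hST, hT⟩ := Finset.exists_le_maximal
    (I.powerset.filter (fun T => g T ≤ T.card)) (a := S) (by simp [hS, ht])
  refine ⟨T, ?_, hST⟩
  have h1 := hT.prop
  simp only [Finset.mem_filter, Finset.mem_powerset] at h1
  simp only [ATight, Finset.mem_filter, Finset.mem_powerset]
  refine ⟨h1.1, hn.mono hST, h1.2, fun S' hS' h' hTS => ?_⟩
  have := hT.eq_of_ge (by simp [hS', h']) hTS
  exact this

theorem ATight_disj (hg : AGood g) {I : Finset α} (hI : AInd g I) {S T : Finset α}
    (hS : S ∈ ATight g I) (hT : T ∈ ATight g I) (hne : S ≠ T) : Disjoint S T := by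
  simp only [ATight, Finset.mem_filter, Finset.mem_powerset] at hS hT
  by_contra hd
  rw [Finset.disjoint_iff_inter_eq_empty, ← ne_eq, ← Finset.nonempty_iff_ne_empty] at hd
  have h1 := hI (S ∩ T) (Finset.inter_subset_left.trans hS.1) hd
  have h2 := hg.sub S T
  have h3 := Finset.card_union_add_card_inter S T
  have h4 : g (S ∪ T) ≤ (S ∪ T).card := by
    have := hS.2.2.1
    have := hT.2.2.1
    zify at h3
    linarith
  have a := hS.2.2.2 _ (Finset.union_subset hS.1 hT.1) h4 Finset.subset_union_left
  have b := hT.2.2.2 _ (Finset.union_subset hS.1 hT.1) h4 Finset.subset_union_right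
  exact hne (a.symm.trans b)

theorem ATight_span (hg : AGood g) {I : Finset α} (hI : AInd g I) {x : α} (hx : x ∉ I)
    (hd : ¬ AInd g (insert x I)) : ∃ T ∈ ATight g I, g (insert x T) ≤ g T := by
  unfold AInd at hd
  push Not at hd
  obtain ⟨S, hS, hn, hlt⟩ := hd
  have hxS : x ∈ S := by
    by_contra hxS
    have := hI S ((Finset.subset_insert_iff_of_notMem hxS).1 hS) hn
    linarith
  have hsub : S.erase x ⊆ I := Finset.erase_subset_iff_of_mem (Finset.mem_insert_self x I) |>.2 hS |> fun h => by
    intro y hy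
    have h1 := hS (Finset.mem_of_mem_erase hy)
    have h2 := Finset.ne_of_mem_erase hy
    simpa [h2] using h1
  have hc := Finset.card_erase_add_one hxS
  have hne : (S.erase x).Nonempty := by
    by_contra he
    rw [Finset.not_nonempty_iff_eq_empty] at he
    have : S = {x} := by rw [← Finset.insert_erase hxS, he]; rfl
    have hp := hg.pos x
    rw [this] at hlt
    simp at hlt
    omega
  have h1 := hg.mono _ _ (Finset.erase_subset x S)
  have h2 := hI _ hsub hne
  have h3 : g (S.erase x) ≤ (S.erase x).card := by omega
  obtain ⟨T, hT, hST⟩ := ATight_exists hsub hne h3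
  refine ⟨T, hT, ?_⟩
  have h4 := hg.sub S T
  have h5 : S ∪ T = insert x T := by
    rw [← Finset.insert_erase hxS, Finset.insert_union, Finset.union_eq_right.2 hST]
  have h6 : g (S.erase x) ≤ g (S ∩ T) :=
    hg.mono _ _ (Finset.subset_inter (Finset.erase_subset x S) hST)
  rw [h5] at h4
  omega

theorem AGood.span_le (hg : AGood g) (T S : Finset α)
    (h : ∀ x ∈ S, g (insert x T) ≤ g T) : g (T ∪ S) ≤ g T := by
  induction S using Finset.induction_on with
  | empty => simp
  | insert x S hx ih =>
    have ih' := ih (fun y hy => h y (Finset.mem_insert_of_mem hy))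
    have h1 := hg.sub (T ∪ S) (insert x T)
    have h2 := hg.mono T ((T ∪ S) ∩ insert x T)
      (Finset.subset_inter Finset.subset_union_left (Finset.subset_insert _ _))
    have h3 := h x (Finset.mem_insert_self _ _)
    have h4 : (T ∪ S) ∪ insert x T = T ∪ insert x S := by
      ext y; simp; tauto
    rw [h4] at h1
    linarith

theorem ATight_card (hg : AGood g) {I : Finset α} (hI : AInd g I) :
    ((ATight g I).biUnion id).card = ∑ T ∈ ATight g I, T.card := by
  rw [Finset.card_biUnion]
  · rfl
  · intro S hS T hT hne
    exact ATight_disj hg hI hS hT hne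

theorem ATight_biUnion_subset {I : Finset α} : (ATight g I).biUnion id ⊆ I := by
  intro x hx
  simp only [Finset.mem_biUnion, id, ATight, Finset.mem_filter, Finset.mem_powerset] at hx
  obtain ⟨T, h, hx⟩ := hx
  exact h.1 hx

theorem A_aug (hg : AGood g) {I J : Finset α} (hI : AInd g I) (hJ : AInd g J)
    (hlt : I.card < J.card) : ∃ e ∈ J, e ∉ I ∧ AInd g (insert e I) := by
  by_contra hcon
  push Not at hcon
  have hcov : J ⊆ (I \ (ATight g I).biUnion id) ∪
      (ATight g I).biUnion (fun T => J.filter (fun x => g (insert x T) ≤ g T)) := by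
    intro x hx
    simp only [Finset.mem_union, Finset.mem_sdiff, Finset.mem_biUnion, Finset.mem_filter, id]
    by_cases hxI : x ∈ I
    · by_cases hT : ∃ T ∈ ATight g I, x ∈ T
      · obtain ⟨T, hT, hxT⟩ := hT
        exact Or.inr ⟨T, hT, hx, by rw [Finset.insert_eq_of_mem hxT]⟩
      · exact Or.inl ⟨hxI, hT⟩
    · obtain ⟨T, hT, h⟩ := ATight_span hg hI hxI (hcon x hx hxI)
      exact Or.inr ⟨T, hT, hx, h⟩
  have h1 := (Finset.card_le_card hcov).trans (Finset.card_union_le _ _)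
  have h2 : ((ATight g I).biUnion (fun T => J.filter (fun x => g (insert x T) ≤ g T))).card
      ≤ ∑ T ∈ ATight g I, T.card := by
    refine Finset.card_biUnion_le.trans (Finset.sum_le_sum fun T hT => ?_)
    rcases Finset.eq_empty_or_nonempty (J.filter (fun x => g (insert x T) ≤ g T)) with he | hne
    · simp [he]
    · have a := hJ _ (Finset.filter_subset _ _) hne
      have b := hg.span_le T (J.filter (fun x => g (insert x T) ≤ g T)) (by simp)
      have c := hg.mono _ _ (Finset.subset_union_right (s₁ := T)
        (s₂ := J.filter (fun x => g (insert x T) ≤ g T)))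
      simp only [ATight, Finset.mem_filter, Finset.mem_powerset] at hT
      have := hT.2.2.1
      omega
  have h3 := Finset.card_sdiff_add_card_eq_card (ATight_biUnion_subset (g := g) (I := I))
  rw [ATight_card hg hI] at h3
  omega

noncomputable def AMat (hg : AGood g) : Matroid α :=
  (IndepMatroid.ofFinset Set.univ (AInd g)
    (by intro S hS hn; simp at hS; simp [hS] at hn)
    (fun _ _ h h' => h.subset h')
    (fun _ _ hI hJ h => A_aug hg hI hJ h)
    (fun _ _ => Set.subset_univ _)).matroid

theorem AMat_indep (hg : AGood g) (I : Finset α) : (AMat hg).Indep I ↔ AInd g I := by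
  change (∀ J : Finset α, (J : Set α) ⊆ I → AInd g J) ↔ _
  exact ⟨fun h => h _ subset_rfl, fun h J hJ => h.subset (by exact_mod_cast hJ)⟩

@[simp] theorem AMat_E (hg : AGood g) : (AMat hg).E = Set.univ := rfl

def ACirc (g : Finset α → ℤ) (C : Finset α) : Prop :=
  ¬ AInd g C ∧ ∀ C' ⊂ C, AInd g C'

theorem A_exists_circ {X : Finset α} (h : ¬ AInd g X) : ∃ C ⊆ X, ACirc g C := by
  induction X using Finset.strongInduction with
  | H X ih =>
    by_cases hc : ∀ C' ⊂ X, AInd g C'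
    · exact ⟨X, subset_rfl, h, hc⟩
    · push Not at hc
      obtain ⟨Y, hY, hd⟩ := hc
      obtain ⟨C, hC, h'⟩ := ih Y hY hd
      exact ⟨C, hC.trans hY.subset, h'⟩

theorem AMat_circ [Finite α] (hg : AGood g) (C : Finset α) :
    (AMat hg).IsCircuit C ↔ ACirc g C := by
  rw [Matroid.isCircuit_iff_forall_ssubset, Matroid.dep_iff, AMat_indep]
  simp only [AMat_E, Set.subset_univ, and_true, ACirc]
  refine and_congr_right fun _ => ⟨fun h C' hC' => ?_, fun h I hI => ?_⟩
  · exact (AMat_indep hg C').1 (h (by exact_mod_cast hC'))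
  · obtain ⟨I', rfl⟩ := (Set.toFinite I).exists_finset_coe
    exact (AMat_indep hg I').2 (h _ (by exact_mod_cast hI))

theorem A_elim [Finite α] (hg : AGood g) {C₁ C₂ : Finset α} (h1 : ACirc g C₁) (h2 : ACirc g C₂)
    {y x : α} (hy1 : y ∈ C₁) (hy2 : y ∈ C₂) (hx1 : x ∈ C₁) (hx2 : x ∉ C₂) :
    ∃ C ⊆ (C₁ ∪ C₂).erase y, ACirc g C ∧ x ∈ C := by
  obtain ⟨C, hC, hC', hx⟩ := ((AMat_circ hg C₁).2 h1).strong_elimination ((AMat_circ hg C₂).2 h2)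
    (e := y) (f := x) (by simpa) (by simpa) (by simpa) (by simpa)
  obtain ⟨C, rfl⟩ := (Set.toFinite C).exists_finset_coe
  refine ⟨C, ?_, (AMat_circ hg C).1 hC', by simpa using hx⟩
  intro z hz
  have := hC (by simpa using hz)
  simp at this ⊢
  tauto

theorem ACirc.not_ssub {C C' : Finset α} (h : ACirc g C) (h' : ACirc g C') (hs : C ⊂ C') : False :=
  h.1 (h'.2 _ hs)

theorem A_trans [Finite α] (hg : AGood g) (n : ℕ) : ∀ {C₁ C₂ : Finset α} (_ : ACirc g C₁)
    (_ : ACirc g C₂) {x z : α} (_ : x ∈ C₁) (_ : z ∈ C₂) (_ : (C₁ ∩ C₂).Nonempty)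
    (_ : (C₁ ∪ C₂).card ≤ n), ∃ C ⊆ C₁ ∪ C₂, ACirc g C ∧ x ∈ C ∧ z ∈ C := by
  induction n with
  | zero =>
    intro C₁ C₂ _ _ x z hx _ _ hc
    have : C₁ ∪ C₂ = ∅ := by simpa using hc
    have := this ▸ Finset.mem_union_left C₂ hx
    simp at this
  | succ n ih =>
    intro C₁ C₂ h1 h2 x z hx hz hn hc
    by_cases hx2 : x ∈ C₂
    · exact ⟨C₂, Finset.subset_union_right, h2, hx2, hz⟩
    by_cases hz1 : z ∈ C₁
    · exact ⟨C₁, Finset.subset_union_left, h1, hx, hz1⟩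
    obtain ⟨y, hy⟩ := hn
    rw [Finset.mem_inter] at hy
    obtain ⟨C₃, hs3, h3, hx3⟩ := A_elim hg h1 h2 hy.1 hy.2 hx hx2
    obtain ⟨C₄, hs4, h4, hz4⟩ := A_elim hg h2 h1 hy.2 hy.1 hz hz1
    rw [Finset.union_comm] at hs4
    have hyU : y ∈ C₁ ∪ C₂ := Finset.mem_union_left _ hy.1
    have e3 := hs3.trans (Finset.erase_subset _ _)
    have e4 := hs4.trans (Finset.erase_subset _ _)
    have n3 : (C₃ ∩ C₂).Nonempty := by
      by_contra he
      rw [Finset.not_nonempty_iff_eq_empty] at he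
      refine h3.not_ssub h1 ⟨fun w hw => ?_, fun hh => ?_⟩
      · have a := e3 hw
        have b : w ∉ C₃ ∩ C₂ := by simp [he]
        simp at a b
        tauto
      · have := hs3 (hh hy.1)
        simp at this
    have n4 : ∃ w ∈ C₄, w ∈ C₁ ∧ w ∉ C₂ := by
      by_contra he
      push Not at he
      refine h4.not_ssub h2 ⟨fun w hw => ?_, fun hh => ?_⟩
      · have a := e4 hw
        have b := he w hw
        simp at a
        tauto
      · have := hs4 (hh hy.2)
        simp at this
    by_cases hss : C₁ ⊆ C₃ ∪ C₂
    · obtain ⟨w, hw4, hw1, hw2⟩ := n4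
      have hw3 : w ∈ C₃ := by
        have := hss hw1
        simp at this
        tauto
      have hU : C₃ ∪ C₄ ⊆ (C₁ ∪ C₂).erase y := Finset.union_subset hs3 hs4
      have hcard := Finset.card_le_card hU
      rw [Finset.card_erase_of_mem hyU] at hcard
      obtain ⟨C, hC, r⟩ := ih h3 h4 hx3 hz4 ⟨w, by simp [hw3, hw4]⟩ (by omega)
      exact ⟨C, hC.trans (Finset.union_subset e3 e4), r⟩
    · have hU : C₃ ∪ C₂ ⊂ C₁ ∪ C₂ := by
        refine ⟨Finset.union_subset e3 Finset.subset_union_right, fun hh => hss ?_⟩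
        exact Finset.subset_union_left.trans hh
      have hcard := Finset.card_lt_card hU
      obtain ⟨C, hC, r⟩ := ih h3 h2 hx3 hz n3 (by omega)
      exact ⟨C, hC.trans hU.subset, r⟩

theorem A_trans' [Finite α] (hg : AGood g) {C₁ C₂ : Finset α} (h1 : ACirc g C₁)
    (h2 : ACirc g C₂) {x y z : α} (hx : x ∈ C₁) (hz : z ∈ C₂) (hy1 : y ∈ C₁) (hy2 : y ∈ C₂) :
    ∃ C ⊆ C₁ ∪ C₂, ACirc g C ∧ x ∈ C ∧ z ∈ C :=
  A_trans hg _ h1 h2 hx hz ⟨y, by simp [hy1, hy2]⟩ le_rfl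

/-- `I` is a maximal independent subset of `X`. -/
def ABasis (g : Finset α → ℤ) (I X : Finset α) : Prop :=
  I ⊆ X ∧ AInd g I ∧ ∀ x ∈ X, x ∉ I → ¬ AInd g (insert x I)

theorem A_ext {I X : Finset α} (hI : AInd g I) (hX : I ⊆ X) : ∃ J, I ⊆ J ∧ ABasis g J X := by
  obtain ⟨T, hST, hT⟩ := Finset.exists_le_maximal
    (X.powerset.filter (fun T => AInd g T)) (a := I) (by simp [hI, hX])
  have h1 := hT.prop
  simp only [Finset.mem_filter, Finset.mem_powerset] at h1
  refine ⟨T, hST, h1.1, h1.2, fun x hx hxT hi => hxT ?_⟩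
  have := hT.le_of_ge (y := insert x T) (by
    simp only [Finset.mem_filter, Finset.mem_powerset]
    exact ⟨Finset.insert_subset hx h1.1, hi⟩) (Finset.subset_insert x T)
  exact this (Finset.mem_insert_self _ _)

theorem ABasis.mat [Finite α] (hg : AGood g) {I X : Finset α} (h : ABasis g I X) :
    (AMat hg).IsBasis (I : Set α) X := by
  rw [Matroid.isBasis_iff (hX := by simp)]
  refine ⟨(AMat_indep hg I).2 h.2.1, by exact_mod_cast h.1, fun J hJ hIJ hJX => ?_⟩
  obtain ⟨J, rfl⟩ := (Set.toFinite J).exists_finset_coe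
  refine hIJ.antisymm fun x hx => ?_
  by_contra hxI
  have hJ' := (AMat_indep hg J).1 hJ
  refine h.2.2 x (by simpa using hJX hx) (by simpa using hxI) (hJ'.subset ?_)
  exact Finset.insert_subset (by simpa using hx) (by exact_mod_cast hIJ)

/-- spanning: if `I` contains a basis of each piece, a basis of `I` is a basis of the union. -/
theorem A_span_basis [Finite α] (hg : AGood g) {I J X : Finset α} (hIX : I ⊆ X)
    (hX : ∀ x ∈ X, ∃ I' Y, ABasis g I' Y ∧ I' ⊆ I ∧ x ∈ Y) (hJ : ABasis g J I) :
    ABasis g J X := by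
  refine ⟨hJ.1.trans hIX, hJ.2.1, fun x hx hxJ hi => ?_⟩
  obtain ⟨I', Y, hb, hI', hxY⟩ := hX x hx
  have a := (hb.mat hg).subset_closure (by simpa using hxY)
  have b := (AMat hg).closure_subset_closure (X := I') (Y := I) (by exact_mod_cast hI') a
  rw [← (hJ.mat hg).closure_eq_closure] at b
  have c := ((AMat_indep hg J).2 hJ.2.1).mem_closure_iff.1 b
  rcases c with c | c
  · exact c.1 (by simpa using (AMat_indep hg _).2 hi)
  · exact hxJ (by simpa using c)

end AbstractCount

section ConcreteCount

theorem mem_VF {V ε : Type} [Fintype V] (π : ε → Sym2 V) (F : Finset ε) (v : V) :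
    v ∈ VF π F ↔ ∃ e ∈ F, v ∈ π e := by
  simp [VF]

theorem fCnt_eq {V ε : Type} [Fintype V] (D : ℕ) (π : ε → Sym2 V) (R : Finset V)
    (F : Finset ε) :
    fCnt D π R F = ∑ v ∈ VF π F, ((D : ℤ) - if v ∈ R then 1 else 0) - D := by
  rw [fCnt, Finset.sum_sub_distrib, Finset.sum_ite_mem]
  simp
  ring

theorem VF_single_card {V ε : Type} [Fintype V] (π : ε → Sym2 V) (e : ε) (h : ¬ (π e).IsDiag) :
    (VF π {e}).card = 2 := by
  have : ∃ a b, π e = s(a, b) := by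
    induction h' : π e using Sym2.ind with
    | _ a b => exact ⟨a, b, rfl⟩
  obtain ⟨a, b, hab⟩ := this
  rw [hab, Sym2.mk_isDiag_iff] at h
  have : VF π {e} = {a, b} := by
    ext v
    simp [mem_VF, hab]
  rw [this, Finset.card_pair h]

theorem VF_inter_le {V ε : Type} [Fintype V] (π : ε → Sym2 V) (R : Finset V) (e : ε)
    (h : ¬ (π e).IsDiag) : (VF π {e} ∩ R).card ≤ 2 := by
  rw [← VF_single_card π e h]
  exact Finset.card_le_card Finset.inter_subset_left

theorem fCnt_single {V ε : Type} [Fintype V] (D : ℕ) (π : ε → Sym2 V) (R : Finset V)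
    (hD : 3 ≤ D) (e : ε) (h : ¬ (π e).IsDiag) :
    fCnt D π R {e} = fMult D π R e := by
  have := VF_inter_le π R e h
  rw [fCnt, fMult, VF_single_card π e h]
  push_cast [Nat.cast_sub (by omega : (VF π {e} ∩ R).card ≤ D)]
  ring

theorem fMult_pos {V ε : Type} [Fintype V] (D : ℕ) (π : ε → Sym2 V) (R : Finset V)
    (hD : 3 ≤ D) (e : ε) (h : ¬ (π e).IsDiag) : 1 ≤ fMult D π R e := by
  have := VF_inter_le π R e h
  rw [fMult]
  omega

theorem fCnt_good {V ε : Type} [Fintype V] [DecidableEq ε] (D : ℕ) (π : ε → Sym2 V) (R : Finset V)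
    (hD : 3 ≤ D) (h : ∀ e, ¬ (π e).IsDiag) : AGood (fCnt D π R) := by
  have key : ∀ A B : Finset V, A ⊆ B → ∑ v ∈ A, ((D : ℤ) - if v ∈ R then 1 else 0)
      ≤ ∑ v ∈ B, ((D : ℤ) - if v ∈ R then 1 else 0) := by
    intro A B hAB
    refine Finset.sum_le_sum_of_subset_of_nonneg hAB fun i _ _ => ?_
    split_ifs <;> omega
  refine ⟨fun S T hST => ?_, fun S T => ?_, fun x => ?_⟩
  · rw [fCnt_eq, fCnt_eq]
    have := key (VF π S) (VF π T) (fun v hv => by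
      rw [mem_VF] at *
      obtain ⟨e, he, hv⟩ := hv
      exact ⟨e, hST he, hv⟩)
    linarith
  · simp only [fCnt_eq]
    have h1 : VF π (S ∪ T) = VF π S ∪ VF π T := by
      ext v
      simp only [mem_VF, Finset.mem_union]
      constructor
      · rintro ⟨e, he | he, hv⟩
        · exact Or.inl ⟨e, he, hv⟩
        · exact Or.inr ⟨e, he, hv⟩
      · rintro (⟨e, he, hv⟩ | ⟨e, he, hv⟩)
        · exact ⟨e, Or.inl he, hv⟩
        · exact ⟨e, Or.inr he, hv⟩
    have h2 := key (VF π (S ∩ T)) (VF π S ∩ VF π T) (fun v hv => by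
      simp only [mem_VF, Finset.mem_inter] at *
      obtain ⟨e, he, hv⟩ := hv
      exact ⟨⟨e, he.1, hv⟩, ⟨e, he.2, hv⟩⟩)
    have h3 := Finset.sum_union_inter (s₁ := VF π S) (s₂ := VF π T)
      (f := fun v => ((D : ℤ) - if v ∈ R then 1 else 0))
    rw [h1]
    linarith
  · rw [fCnt_single D π R hD x (h x)]
    exact_mod_cast fMult_pos D π R hD x (h x)

variable {V E : Type} [Fintype V] [DecidableEq E]
variable {D : ℕ} {π : E → Sym2 V} {R : Finset V}

/-- count function upstairs -/
noncomputable def gUp (D : ℕ) (π : E → Sym2 V) (R : Finset V) : Finset (E × Fin D) → ℤ :=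
  fCnt D (fun x : E × Fin D => π x.1) R

theorem gUp_eq (X : Finset (E × Fin D)) : gUp D π R X = fCnt D π R (X.image Prod.fst) := by
  have : VF (fun x : E × Fin D => π x.1) X = VF π (X.image Prod.fst) := by
    ext v
    simp only [mem_VF, Finset.mem_image]
    constructor
    · rintro ⟨x, hx, hv⟩
      exact ⟨x.1, ⟨x, hx, rfl⟩, hv⟩
    · rintro ⟨_, ⟨x, hx, rfl⟩, hv⟩
      exact ⟨x, hx, hv⟩
  rw [gUp, fCnt, fCnt, this]

theorem mem_fCopy {F : Finset E} {x : E × Fin D} :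
    x ∈ fCopy D π R F ↔ x.1 ∈ F ∧ (x.2 : ℕ) < fMult D π R x.1 := by
  obtain ⟨e, i⟩ := x
  simp only [fCopy, Finset.mem_biUnion, Finset.mem_product, Finset.mem_singleton,
    Finset.mem_filter, Finset.mem_univ, true_and]
  constructor
  · rintro ⟨a, ha, rfl, h⟩
    exact ⟨ha, h⟩
  · rintro ⟨ha, h⟩
    exact ⟨e, ha, rfl, h⟩

theorem fCopy_mono {F F' : Finset E} (h : F ⊆ F') : fCopy D π R F ⊆ fCopy D π R F' := by
  intro x hx
  rw [mem_fCopy] at *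
  exact ⟨h hx.1, hx.2⟩

theorem fCopy_exists (hD : 3 ≤ D) (hπ : ∀ e, ¬ (π e).IsDiag) (e : E) :
    ∃ x : E × Fin D, x.1 = e ∧ (x.2 : ℕ) < fMult D π R x.1 :=
  ⟨(e, ⟨0, by omega⟩), rfl, fMult_pos D π R hD e (hπ e)⟩

theorem fCopy_subset (hD : 3 ≤ D) (hπ : ∀ e, ¬ (π e).IsDiag) {F F' : Finset E}
    (h : fCopy D π R F ⊆ fCopy D π R F') : F ⊆ F' := by
  intro e he
  obtain ⟨x, rfl, hx⟩ := fCopy_exists (R := R) hD hπ e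
  exact (mem_fCopy.1 (h (mem_fCopy.2 ⟨he, hx⟩))).1

theorem fCopy_single_card (e : E) :
    (fCopy D π R {e}).card = fMult D π R e := by
  have : fMult D π R e ≤ D := Nat.sub_le _ _
  rw [fCopy, Finset.singleton_biUnion, Finset.card_product, Finset.card_singleton, one_mul,
    Fin.card_filter_val_lt]
  omega

theorem gUp_good (hD : 3 ≤ D) (hπ : ∀ e, ¬ (π e).IsDiag) : AGood (gUp D π R) :=
  fCnt_good D _ R hD (fun x => hπ x.1)

theorem gUp_le (hD : 3 ≤ D) (hπ : ∀ e, ¬ (π e).IsDiag) {X : Finset (E × Fin D)} {F : Finset E}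
    (h : X ⊆ fCopy D π R F) : gUp D π R X ≤ fCnt D π R F := by
  rw [gUp_eq]
  refine (fCnt_good D π R hD hπ).mono _ _ fun e he => ?_
  rw [Finset.mem_image] at he
  obtain ⟨x, hx, rfl⟩ := he
  exact (mem_fCopy.1 (h hx)).1

/-! fHat -/

theorem fHat_bdd [Fintype E] (F : Finset E) :
    BddBelow {s : ℤ | ∃ P : Finset (Finset E), IsPartitionOf F P ∧ s = ∑ p ∈ P, fCnt D π R p} := by
  apply Set.Finite.bddBelow
  refine (Set.finite_range (fun P : Finset (Finset E) => ∑ p ∈ P, fCnt D π R p)).subset ?_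
  rintro s ⟨P, -, rfl⟩
  exact ⟨P, rfl⟩

theorem fHat_le [Fintype E] {F : Finset E} {P : Finset (Finset E)} (hP : IsPartitionOf F P) :
    fHat D π R F ≤ ∑ p ∈ P, fCnt D π R p :=
  csInf_le (fHat_bdd F) ⟨P, hP, rfl⟩

theorem part_single {F : Finset E} (hF : F.Nonempty) : IsPartitionOf F {F} := by
  refine ⟨by simpa using hF, by simp, by simp⟩

theorem fHat_attain [Fintype E] (F : Finset E) :
    ∃ P, IsPartitionOf F P ∧ fHat D π R F = ∑ p ∈ P, fCnt D π R p := by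
  refine Int.csInf_mem (s := {s : ℤ | ∃ P : Finset (Finset E), IsPartitionOf F P ∧
    s = ∑ p ∈ P, fCnt D π R p}) ?_ (fHat_bdd F)
  rcases F.eq_empty_or_nonempty with rfl | hF
  · exact ⟨_, ∅, ⟨by simp, by simp, by simp⟩, rfl⟩
  · exact ⟨_, {F}, part_single hF, rfl⟩

theorem part_mem {F : Finset E} {P : Finset (Finset E)} (hP : IsPartitionOf F P) {e : E} :
    e ∈ F ↔ ∃ p ∈ P, e ∈ p := by
  rw [← hP.2.2]; simp

theorem part_disj {F : Finset E} {P : Finset (Finset E)} (hP : IsPartitionOf F P) {p q : Finset E}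
    (hp : p ∈ P) (hq : q ∈ P) {e : E} (h1 : e ∈ p) (h2 : e ∈ q) : p = q := by
  by_contra hne
  exact Finset.disjoint_left.1 (hP.2.1 hp hq hne) h1 h2

theorem part_sub {F : Finset E} {P : Finset (Finset E)} (hP : IsPartitionOf F P) {p : Finset E}
    (hp : p ∈ P) : p ⊆ F := fun _ he => (part_mem hP).2 ⟨p, hp, he⟩

theorem card_part {F : Finset E} {P : Finset (Finset E)} (hP : IsPartitionOf F P)
    {I : Finset E → Finset (E × Fin D)} (hI : ∀ p ∈ P, I p ⊆ fCopy D π R p) :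
    (P.biUnion I).card = ∑ p ∈ P, (I p).card := by
  apply Finset.card_biUnion
  intro p hp q hq hne
  simp only [Function.onFun]
  rw [Finset.disjoint_left]
  intro x hx hx'
  exact hne (part_disj hP hp hq (mem_fCopy.1 (hI p hp hx)).1 (mem_fCopy.1 (hI q hq hx')).1)

theorem part_filter {F : Finset E} {P : Finset (Finset E)} (hP : IsPartitionOf F P)
    {X : Finset (E × Fin D)} (hX : X ⊆ fCopy D π R F) :
    X.card = ∑ p ∈ P, (X ∩ fCopy D π R p).card := by
  rw [← card_part (π := π) (R := R) hP (fun p _ => Finset.inter_subset_right)]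
  congr 1
  ext x
  simp only [Finset.mem_biUnion, Finset.mem_inter]
  constructor
  · intro hx
    have h := mem_fCopy.1 (hX hx)
    obtain ⟨p, hp, he⟩ := (part_mem hP).1 h.1
    exact ⟨p, hp, hx, mem_fCopy.2 ⟨he, h.2⟩⟩
  · rintro ⟨p, _, hx, _⟩
    exact hx

theorem cnt_rank_le [Fintype E] (hD : 3 ≤ D) (hπ : ∀ e, ¬ (π e).IsDiag) {F : Finset E}
    {I : Finset (E × Fin D)} (hI : AInd (gUp D π R) I) (hs : I ⊆ fCopy D π R F) :
    (I.card : ℤ) ≤ fHat D π R F := by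
  obtain ⟨P, hP, h⟩ := fHat_attain (D := D) (π := π) (R := R) F
  rw [h, part_filter hP hs]
  push_cast
  refine Finset.sum_le_sum fun p hp => ?_
  rcases (I ∩ fCopy D π R p).eq_empty_or_nonempty with he | hne
  · rw [he]
    obtain ⟨e, he⟩ := hP.1 p hp
    have h1 := (fCnt_good D π R hD hπ).pos e
    have h2 := (fCnt_good D π R hD hπ).mono {e} p (by simpa using he)
    simp
    omega
  · exact (hI _ Finset.inter_subset_left hne).trans (gUp_le hD hπ Finset.inter_subset_right)

theorem basis_le [Fintype E] (hD : 3 ≤ D) (hπ : ∀ e, ¬ (π e).IsDiag) {F : Finset E}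
    {I : Finset (E × Fin D)} (hI : ABasis (gUp D π R) I (fCopy D π R F)) :
    fHat D π R F ≤ (I.card : ℤ) := by
  have hg := gUp_good (R := R) hD hπ
  have key : ∀ e ∈ F, ∃ T x, T ∈ ATight (gUp D π R) I ∧ x.1 = e ∧
      gUp D π R (insert x T) ≤ gUp D π R T := by
    intro e he
    by_cases hall : fCopy D π R {e} ⊆ I
    · obtain ⟨x, rfl, hx⟩ := fCopy_exists (R := R) hD hπ e
      have hxm : x ∈ fCopy D π R {x.1} := mem_fCopy.2 ⟨by simp, hx⟩
      obtain ⟨T, hT, hs⟩ := ATight_exists (g := gUp D π R) hall ⟨x, hxm⟩ (by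
        rw [fCopy_single_card, ← fCnt_single D π R hD _ (hπ _)]
        exact gUp_le hD hπ subset_rfl)
      exact ⟨T, x, hT, rfl, by rw [Finset.insert_eq_of_mem (hs hxm)]⟩
    · obtain ⟨x, hx, hxI⟩ := Finset.not_subset.1 hall
      have hx' := mem_fCopy.1 hx
      have hxe : x.1 = e := by simpa using hx'.1
      obtain ⟨T, hT, h⟩ := ATight_span hg hI.2.1 hxI
        (hI.2.2 x (mem_fCopy.2 ⟨by rwa [hxe], hx'.2⟩) hxI)
      exact ⟨T, x, hT, hxe, h⟩
  have key' : ∀ e, ∃ T x, e ∈ F → T ∈ ATight (gUp D π R) I ∧ x.1 = e ∧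
      gUp D π R (insert x T) ≤ gUp D π R T := by
    intro e
    by_cases he : e ∈ F
    · obtain ⟨T, x, h⟩ := key e he
      exact ⟨T, x, fun _ => h⟩
    · exact ⟨∅, (e, ⟨0, by omega⟩), fun h => absurd h he⟩
  choose c x hk using key'
  have hc := fun e he => (hk e he).1
  have hx := fun e he => (hk e he).2.1
  have hcx := fun e he => (hk e he).2.2
  set FT : Finset (E × Fin D) → Finset E := fun T => F.filter (fun e => c e = T) with hFT
  have hinj : Set.InjOn FT (F.image c : Finset _) := by
    intro T hT T' hT' h
    simp only [Finset.coe_image, Set.mem_image, Finset.mem_coe] at hT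
    obtain ⟨e, he, rfl⟩ := hT
    have : e ∈ FT (c e) := by simp [hFT, he]
    rw [h] at this
    simp [hFT] at this
    exact this.2
  have hP : IsPartitionOf F ((F.image c).image FT) := by
    refine ⟨?_, ?_, ?_⟩
    · intro p hp
      simp only [Finset.mem_image, exists_exists_and_eq_and] at hp
      obtain ⟨e, he, rfl⟩ := hp
      exact ⟨e, by simp [hFT, he]⟩
    · intro p hp q hq hne
      simp only [Finset.coe_image, Set.mem_image, Finset.mem_coe, exists_exists_and_eq_and] at hp hq
      obtain ⟨e, he, rfl⟩ := hp
      obtain ⟨e', he', rfl⟩ := hq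
      simp only [Function.onFun, id]
      rw [Finset.disjoint_left]
      intro a ha hb
      simp [hFT] at ha hb
      exact hne (by rw [← ha.2, ← hb.2])
    · ext e
      simp only [Finset.mem_biUnion, Finset.mem_image, exists_exists_and_eq_and, id]
      constructor
      · rintro ⟨a, _, h⟩
        simp [hFT] at h
        exact h.1
      · intro he
        exact ⟨e, he, by simp [hFT, he]⟩
  have hsubT : F.image c ⊆ ATight (gUp D π R) I := by
    intro T hT
    rw [Finset.mem_image] at hT
    obtain ⟨e, he, rfl⟩ := hT
    exact hc e he
  have h1 := fHat_le (D := D) (π := π) (R := R) hP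
  rw [Finset.sum_image hinj] at h1
  have h2 : ∑ T ∈ F.image c, fCnt D π R (FT T) ≤ ∑ T ∈ F.image c, (T.card : ℤ) := by
    refine Finset.sum_le_sum fun T hT => ?_
    have a := hg.span_le T ((FT T).image x) (by
      intro y hy
      rw [Finset.mem_image] at hy
      obtain ⟨e, he, rfl⟩ := hy
      simp only [hFT, Finset.mem_filter] at he
      have := hcx e he.1
      rwa [he.2] at this)
    have b : fCnt D π R (FT T) ≤ gUp D π R (T ∪ (FT T).image x) := by
      rw [gUp_eq]
      refine (fCnt_good D π R hD hπ).mono _ _ fun e he => ?_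
      rw [Finset.mem_image]
      refine ⟨x e, Finset.mem_union_right _ (Finset.mem_image_of_mem _ he), hx e ?_⟩
      exact (Finset.mem_filter.1 he).1
    have hT' := hsubT hT
    simp only [ATight, Finset.mem_filter] at hT'
    linarith [hT'.2.2.1]
  have h3 : ∑ T ∈ F.image c, (T.card : ℤ) ≤ ∑ T ∈ ATight (gUp D π R) I, (T.card : ℤ) :=
    Finset.sum_le_sum_of_subset_of_nonneg hsubT (fun _ _ _ => by positivity)
  have h4 := Finset.card_le_card (ATight_biUnion_subset (g := gUp D π R) (I := I))
  rw [ATight_card hg hI.2.1] at h4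
  have h5 : (∑ T ∈ ATight (gUp D π R) I, (T.card : ℤ)) ≤ I.card := by exact_mod_cast h4
  linarith

theorem basis_eq [Fintype E] (hD : 3 ≤ D) (hπ : ∀ e, ¬ (π e).IsDiag) {F : Finset E}
    {I : Finset (E × Fin D)} (hI : ABasis (gUp D π R) I (fCopy D π R F)) :
    (I.card : ℤ) = fHat D π R F :=
  (cnt_rank_le hD hπ hI.2.1 hI.1).antisymm (basis_le hD hπ hI)

theorem AInd_empty : AInd (gUp D π R) ∅ := by
  intro S hS hn
  simp at hS
  simp [hS] at hn

theorem fHat_subadd [Fintype E] (hD : 3 ≤ D) (hπ : ∀ e, ¬ (π e).IsDiag) {F : Finset E}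
    {P : Finset (Finset E)} (hP : IsPartitionOf F P) :
    fHat D π R F ≤ ∑ p ∈ P, fHat D π R p := by
  obtain ⟨I, -, hI⟩ := A_ext (X := fCopy D π R F) (AInd_empty (π := π) (R := R)) (by simp)
  rw [← basis_eq hD hπ hI, part_filter hP hI.1]
  push_cast
  exact Finset.sum_le_sum fun p hp =>
    cnt_rank_le hD hπ (hI.2.1.subset Finset.inter_subset_left) Finset.inter_subset_right

theorem sep_of_circ [Fintype E] (hD : 3 ≤ D) (hπ : ∀ e, ¬ (π e).IsDiag) {F : Finset E}
    {P : Finset (Finset E)} (hP : IsPartitionOf F P)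
    (h : ∀ C ⊆ fCopy D π R F, ACirc (gUp D π R) C → ∃ p ∈ P, C ⊆ fCopy D π R p) :
    fHat D π R F = ∑ p ∈ P, fHat D π R p := by
  refine (fHat_subadd hD hπ hP).antisymm ?_
  have hb : ∀ p : Finset E, ∃ I, ABasis (gUp D π R) I (fCopy D π R p) := fun p => by
    obtain ⟨I, -, hI⟩ := A_ext (X := fCopy D π R p) (AInd_empty (π := π) (R := R)) (by simp)
    exact ⟨I, hI⟩
  choose I hI using hb
  have hsub : P.biUnion I ⊆ fCopy D π R F := by
    rw [Finset.biUnion_subset]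
    exact fun p hp => (hI p).1.trans (fCopy_mono (part_sub hP hp))
  have hind : AInd (gUp D π R) (P.biUnion I) := by
    by_contra hd
    obtain ⟨C, hC, hc⟩ := A_exists_circ hd
    obtain ⟨p, hp, hCp⟩ := h C (hC.trans hsub) hc
    refine hc.1 ((hI p).2.1.subset fun x hx => ?_)
    have := hC hx
    rw [Finset.mem_biUnion] at this
    obtain ⟨q, hq, hxq⟩ := this
    have := part_disj hP hp hq (mem_fCopy.1 (hCp hx)).1 (mem_fCopy.1 ((hI q).1 hxq)).1
    rwa [this]
  have := cnt_rank_le hD hπ hind hsub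
  rw [card_part hP (fun p _ => (hI p).1)] at this
  push_cast at this
  simpa only [basis_eq hD hπ (hI _)] using this

theorem circ_of_sep [Fintype E] (hD : 3 ≤ D) (hπ : ∀ e, ¬ (π e).IsDiag) {F : Finset E}
    {P : Finset (Finset E)} (hP : IsPartitionOf F P)
    (h : fHat D π R F = ∑ p ∈ P, fHat D π R p) {C : Finset (E × Fin D)}
    (hC : C ⊆ fCopy D π R F) (hc : ACirc (gUp D π R) C) : ∃ p ∈ P, C ⊆ fCopy D π R p := by
  by_contra hcon
  push Not at hcon
  have hg := gUp_good (R := R) hD hπ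
  have hb : ∀ p : Finset E, ∃ I, p ∈ P → C ∩ fCopy D π R p ⊆ I ∧
      ABasis (gUp D π R) I (fCopy D π R p) := fun p => by
    by_cases hp : p ∈ P
    · have : C ∩ fCopy D π R p ⊂ C := by
        refine ⟨Finset.inter_subset_left, fun hs => hcon p hp ?_⟩
        exact hs.trans Finset.inter_subset_right
      obtain ⟨I, h, hI⟩ := A_ext (hc.2 _ this) (Finset.inter_subset_right (s₁ := C)
        (s₂ := fCopy D π R p))
      exact ⟨I, fun _ => ⟨h, hI⟩⟩
    · exact ⟨∅, fun h => absurd h hp⟩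
  choose I hI using hb
  have hsub : P.biUnion I ⊆ fCopy D π R F := by
    rw [Finset.biUnion_subset]
    exact fun p hp => (hI p hp).2.1.trans (fCopy_mono (part_sub hP hp))
  obtain ⟨J, -, hJ⟩ := A_ext (X := P.biUnion I) (AInd_empty (π := π) (R := R)) (by simp)
  have hJF : ABasis (gUp D π R) J (fCopy D π R F) := by
    refine A_span_basis hg hsub (fun x hx => ?_) hJ
    have hx' := mem_fCopy.1 hx
    obtain ⟨p, hp, hxp⟩ := (part_mem hP).1 hx'.1
    exact ⟨I p, fCopy D π R p, (hI p hp).2, Finset.subset_biUnion_of_mem I hp,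
      mem_fCopy.2 ⟨hxp, hx'.2⟩⟩
  have h1 := basis_eq hD hπ hJF
  have h2 := card_part hP (fun p hp => (hI p hp).2.1)
  have h3 : ((P.biUnion I).card : ℤ) = J.card := by
    rw [h1, h, h2]
    push_cast
    exact Finset.sum_congr rfl fun p hp => basis_eq hD hπ (hI p hp).2
  have h4 : J = P.biUnion I := Finset.eq_of_subset_of_card_le hJ.1 (by omega)
  refine hc.1 (hJ.2.1.subset fun x hx => ?_)
  rw [h4, Finset.mem_biUnion]
  have hx' := mem_fCopy.1 (hC hx)
  obtain ⟨p, hp, hxp⟩ := (part_mem hP).1 hx'.1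
  exact ⟨p, hp, (hI p hp).1 (Finset.mem_inter.2 ⟨hx, mem_fCopy.2 ⟨hxp, hx'.2⟩⟩)⟩

end ConcreteCount

section FinalCount

variable {V E : Type} [Fintype V] [DecidableEq E]
variable {D : ℕ} {π : E → Sym2 V} {R : Finset V}

theorem AInd_map {α : Type} {g : Finset α → ℤ} {σ : Equiv.Perm α}
    (h : ∀ X, g (X.map σ.toEmbedding) = g X) {X : Finset α} :
    AInd g X → AInd g (X.map σ.toEmbedding) := by
  intro hX S hS hn
  have h1 : (S.map σ.symm.toEmbedding).map σ.toEmbedding = S := by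
    ext x; simp [Finset.mem_map_equiv]
  have h2 : S.map σ.symm.toEmbedding ⊆ X := by
    intro x hx
    rw [Finset.mem_map_equiv] at hx
    have := hS hx
    rw [Finset.mem_map_equiv] at this
    simpa using this
  have h3 := hX _ h2 (by simpa using hn)
  rw [← h, h1] at h3
  simpa using h3

theorem ACirc_map {α : Type} {g : Finset α → ℤ} {σ : Equiv.Perm α}
    (h : ∀ X, g (X.map σ.toEmbedding) = g X) {X : Finset α} (hX : ACirc g X) :
    ACirc g (X.map σ.toEmbedding) := by
  have e1 : ∀ S : Finset α, (S.map σ.symm.toEmbedding).map σ.toEmbedding = S := by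
    intro S; ext x; simp [Finset.mem_map_equiv]
  have e2 : ∀ S : Finset α, (S.map σ.toEmbedding).map σ.symm.toEmbedding = S := by
    intro S; ext x; simp [Finset.mem_map_equiv]
  have h' : ∀ X, g (X.map σ.symm.toEmbedding) = g X := fun X => by rw [← h, e1]
  refine ⟨fun hi => hX.1 ?_, fun C hC => ?_⟩
  · have := AInd_map h' hi
    rwa [e2] at this
  · rw [← e1 C]
    refine AInd_map h (hX.2 _ ?_)
    rw [← e2 X]
    exact (Finset.map_ssubset_map).2 hC

theorem clone (hD : 3 ≤ D) [Fintype E] (hπ : ∀ e, ¬ (π e).IsDiag) {C : Finset (E × Fin D)}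
    (hC : ACirc (gUp D π R) C) {x y y' : E × Fin D} (hx : x ∈ C) (hy : y ∈ C) (hyy : y'.1 = y.1) :
    ∃ C' ⊆ insert y' C, ACirc (gUp D π R) C' ∧ x ∈ C' ∧ y' ∈ C' := by
  have hg := gUp_good (R := R) hD hπ
  by_cases hy' : y' ∈ C
  · exact ⟨C, Finset.subset_insert _ _, hC, hx, hy'⟩
  have hw : ∃ w ∈ C, w ≠ y := by
    by_contra hcon
    push Not at hcon
    refine hC.1 fun S hS hn => ?_
    obtain ⟨z, hz⟩ := hn
    have : S = {z} := by
      rw [Finset.eq_singleton_iff_unique_mem]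
      exact ⟨hz, fun t ht => (hcon t (hS ht)).trans (hcon z (hS hz)).symm⟩
    rw [this]
    simpa using hg.pos z
  obtain ⟨w, hwC, hwy⟩ := hw
  have hσ : ∀ X, gUp D π R (X.map (Equiv.swap y y').toEmbedding) = gUp D π R X := by
    intro X
    rw [gUp_eq, gUp_eq]
    congr 1
    have hf : ∀ z, ((Equiv.swap y y') z).1 = z.1 := by
      intro z
      by_cases h1 : z = y
      · subst h1; rw [Equiv.swap_apply_left, hyy]
      by_cases h2 : z = y'
      · subst h2; rw [Equiv.swap_apply_right, hyy]
      rw [Equiv.swap_apply_of_ne_of_ne h1 h2]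
    rw [Finset.map_eq_image, Finset.image_image]
    refine Finset.image_congr fun z _ => ?_
    simpa using hf z
  have hC' := ACirc_map hσ hC
  have hwC' : w ∈ C.map (Equiv.swap y y').toEmbedding := by
    rw [Finset.mem_map_equiv, Equiv.symm_swap, Equiv.swap_apply_of_ne_of_ne hwy]
    · exact hwC
    · rintro rfl; exact hy' hwC
  have hyC' : y' ∈ C.map (Equiv.swap y y').toEmbedding := by
    rw [Finset.mem_map_equiv, Equiv.symm_swap, Equiv.swap_apply_right]
    exact hy
  obtain ⟨C'', hs, h⟩ := A_trans' hg hC hC' hx hyC' hwC hwC'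
  refine ⟨C'', hs.trans ?_, h⟩
  refine Finset.union_subset (Finset.subset_insert _ _) fun z hz => ?_
  rw [Finset.mem_map_equiv, Equiv.symm_swap] at hz
  by_cases h2 : z = y'
  · simp [h2]
  by_cases h1 : z = y
  · subst h1; simp [hy]
  rw [Equiv.swap_apply_of_ne_of_ne h1 h2] at hz
  simp [hz]

def CRel (D : ℕ) (π : E → Sym2 V) (R : Finset V) (X : Finset (E × Fin D)) (x y : E × Fin D) : Prop :=
  ∃ C ⊆ X, ACirc (gUp D π R) C ∧ x ∈ C ∧ y ∈ C

theorem CRel.symm {X : Finset (E × Fin D)} {x y} (h : CRel D π R X x y) : CRel D π R X y x := by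
  obtain ⟨C, h1, h2, h3, h4⟩ := h
  exact ⟨C, h1, h2, h4, h3⟩

theorem CRel.mono {X Y : Finset (E × Fin D)} {x y} (h : CRel D π R X x y) (hs : X ⊆ Y) :
    CRel D π R Y x y := by
  obtain ⟨C, h1, h⟩ := h
  exact ⟨C, h1.trans hs, h⟩

theorem CRel.trans [Fintype E] (hD : 3 ≤ D) (hπ : ∀ e, ¬ (π e).IsDiag)
    {X : Finset (E × Fin D)} {x y z} (h : CRel D π R X x y)
    (h' : CRel D π R X y z) : CRel D π R X x z := by
  obtain ⟨C, h1, h2, h3, h4⟩ := h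
  obtain ⟨C', h1', h2', h3', h4'⟩ := h'
  obtain ⟨C'', hs, r⟩ := A_trans' (gUp_good hD hπ) h2 h2' h3 h4' h4 h3'
  exact ⟨C'', hs.trans (Finset.union_subset h1 h1'), r⟩

theorem CRel.clone [Fintype E] (hD : 3 ≤ D) (hπ : ∀ e, ¬ (π e).IsDiag)
    {X : Finset (E × Fin D)} {x y y'} (h : CRel D π R X x y) (hy : y'.1 = y.1) (hX : y' ∈ X) :
    CRel D π R X x y' := by
  obtain ⟨C, h1, h2, h3, h4⟩ := h
  obtain ⟨C', hs, r⟩ := _root_.clone hD hπ h2 h3 h4 hy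
  exact ⟨C', hs.trans (Finset.insert_subset hX h1), r⟩

theorem not_PConn [Fintype E] (hD : 3 ≤ D) (hπ : ∀ e, ¬ (π e).IsDiag) {F F1 : Finset E}
    (hs : F1 ⊆ F) (hn : F1.Nonempty) (hne : F1 ≠ F)
    (h : ∀ C ⊆ fCopy D π R F, ACirc (gUp D π R) C → ∀ x ∈ C, x ∈ fCopy D π R F1 →
      C ⊆ fCopy D π R F1) : ¬ PConn D π R F := by
  intro hP
  have hn2 : (F \ F1).Nonempty := by
    rw [Finset.sdiff_nonempty]
    exact fun h => hne (hs.antisymm h)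
  have hne' : F1 ≠ F \ F1 := by
    intro he
    obtain ⟨e, h1⟩ := hn
    have := he ▸ h1
    simp at this
    exact this.2 h1
  have hQ : IsPartitionOf F {F1, F \ F1} := by
    refine ⟨?_, ?_, ?_⟩
    · simp [hn, hn2]
    · intro a ha b hb hab
      simp only [Finset.coe_insert, Finset.coe_singleton, Set.mem_insert_iff,
        Set.mem_singleton_iff] at ha hb
      simp only [Function.onFun, id]
      rcases ha with rfl | rfl <;> rcases hb with rfl | rfl
      · exact absurd rfl hab
      · exact Finset.disjoint_sdiff
      · exact Finset.sdiff_disjoint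
      · exact absurd rfl hab
    · simp [hs]
  refine hP.2 _ hQ (by rw [Finset.card_pair hne']) (sep_of_circ hD hπ hQ fun C hC hc => ?_)
  by_cases hx : ∃ x ∈ C, x ∈ fCopy D π R F1
  · obtain ⟨x, hx, hx1⟩ := hx
    exact ⟨F1, by simp, h C hC hc x hx hx1⟩
  · push Not at hx
    refine ⟨F \ F1, by simp, fun x hxC => ?_⟩
    have h1 := mem_fCopy.1 (hC hxC)
    have h2 := hx x hxC
    rw [mem_fCopy] at h2 ⊢
    rw [Finset.mem_sdiff]
    tauto

theorem partII [Fintype E] (hD : 3 ≤ D) (hπ : ∀ e, ¬ (π e).IsDiag) {F : Finset E}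
    (hF : PConn D π R F) (h2 : 2 ≤ F.card) :
    ∀ x ∈ fCopy D π R F, ∀ y ∈ fCopy D π R F, CRel D π R (fCopy D π R F) x y := by
  intro x hx
  have hx' := mem_fCopy.1 hx
  have hxx : CRel D π R (fCopy D π R F) x x := by
    by_contra hcon
    refine not_PConn hD hπ (F1 := {x.1}) (by simpa using hx'.1) (by simp) ?_ ?_ hF
    · intro he
      rw [← he] at h2
      simp at h2
    · intro C hC hc z hz hz1
      exfalso
      apply hcon
      have hz1 := mem_fCopy.1 hz1
      have hzx : z.1 = x.1 := by simpa using hz1.1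
      have a : CRel D π R (fCopy D π R F) z z := ⟨C, hC, hc, hz, hz⟩
      have b := a.clone hD hπ (y' := x) hzx.symm hx
      exact b.symm.trans hD hπ b
  by_contra hcon
  push Not at hcon
  obtain ⟨y, hy, hxy⟩ := hcon
  set K := (fCopy D π R F).filter (fun z => CRel D π R (fCopy D π R F) x z) with hK
  have hKm : ∀ z ∈ fCopy D π R F, (z ∈ fCopy D π R (K.image Prod.fst) ↔
      CRel D π R (fCopy D π R F) x z) := by
    intro z hz
    constructor
    · intro h
      have h1 := (mem_fCopy.1 h).1
      rw [Finset.mem_image] at h1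
      obtain ⟨w, hw, hwz⟩ := h1
      rw [hK, Finset.mem_filter] at hw
      exact hw.2.clone hD hπ hwz.symm hz
    · intro h
      exact mem_fCopy.2 ⟨Finset.mem_image.2 ⟨z, by rw [hK, Finset.mem_filter]; exact ⟨hz, h⟩, rfl⟩,
        (mem_fCopy.1 hz).2⟩
  have hsub : K.image Prod.fst ⊆ F := by
    intro e he
    rw [Finset.mem_image] at he
    obtain ⟨w, hw, rfl⟩ := he
    rw [hK, Finset.mem_filter] at hw
    exact (mem_fCopy.1 hw.1).1
  refine not_PConn hD hπ (F1 := K.image Prod.fst) hsub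
    ⟨x.1, (mem_fCopy.1 ((hKm x hx).2 hxx)).1⟩ ?_ ?_ hF
  · intro he
    rw [he] at hKm
    exact hxy ((hKm y hy).1 hy)
  · intro C hC hc z hz hzK w hw
    have h1 := (hKm z (hC hz)).1 hzK
    exact (hKm w (hC hw)).2 (h1.trans hD hπ ⟨C, hC, hc, hz, hw⟩)

theorem compK [Fintype E] (hD : 3 ≤ D) (hπ : ∀ e, ¬ (π e).IsDiag) {x : E × Fin D}
    (hx : CRel D π R (fCopy D π R Finset.univ) x x) :
    ∃ F : Finset E, PConnComp D π R Finset.univ F ∧ 2 ≤ F.card ∧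
      ∀ y, y ∈ fCopy D π R F ↔ CRel D π R (fCopy D π R Finset.univ) x y := by
  set U := fCopy D π R Finset.univ with hU
  set K := U.filter (fun z => CRel D π R U x z) with hK
  have hRU : ∀ {a b}, CRel D π R U a b → b ∈ U := fun ⟨C, h1, _, _, h4⟩ => h1 h4
  set F := K.image Prod.fst with hF
  have hFm : ∀ y, y ∈ fCopy D π R F ↔ CRel D π R U x y := by
    intro z
    constructor
    · intro h
      have hz : z ∈ U := fCopy_mono (Finset.subset_univ _) h
      have h1 := (mem_fCopy.1 h).1
      rw [Finset.mem_image] at h1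
      obtain ⟨w, hw, hwz⟩ := h1
      rw [hK, Finset.mem_filter] at hw
      exact hw.2.clone hD hπ hwz.symm hz
    · intro h
      exact mem_fCopy.2 ⟨Finset.mem_image.2 ⟨z, by
        rw [hK, Finset.mem_filter]; exact ⟨hRU h, h⟩, rfl⟩, (mem_fCopy.1 (hRU h)).2⟩
  have hconn : ∀ y ∈ fCopy D π R F, ∀ z ∈ fCopy D π R F, CRel D π R (fCopy D π R F) y z := by
    intro y hy z hz
    have h1 := (hFm y).1 hy
    obtain ⟨C, hC, hc, hyC, hzC⟩ := h1.symm.trans hD hπ ((hFm z).1 hz)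
    refine ⟨C, fun w hw => (hFm w).2 (h1.trans hD hπ ⟨C, hC, hc, hyC, hw⟩), hc, hyC, hzC⟩
  have hxF := (hFm x).2 hx
  have h2 : 2 ≤ F.card := by
    by_contra hlt
    have h1 : F.card ≤ 1 := by omega
    have hFe : F = {x.1} := by
      rw [Finset.eq_singleton_iff_unique_mem]
      refine ⟨(mem_fCopy.1 hxF).1, fun y hy => ?_⟩
      exact Finset.card_le_one.1 h1 _ hy _ (mem_fCopy.1 hxF).1
    obtain ⟨C, hC, hc, -, -⟩ := hconn x hxF x hxF
    refine hc.1 fun S hS ⟨z, hz⟩ => ?_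
    have hSF := hS.trans hC
    rw [hFe] at hSF
    have a := Finset.card_le_card hSF
    rw [fCopy_single_card] at a
    have b := fCnt_single D π R hD x.1 (hπ _)
    have c : fCnt D π R {x.1} ≤ gUp D π R S := by
      rw [gUp_eq]
      refine (fCnt_good D π R hD hπ).mono _ _ ?_
      have : z.1 = x.1 := by simpa using (mem_fCopy.1 (hSF hz)).1
      rw [Finset.singleton_subset_iff, ← this]
      exact Finset.mem_image_of_mem _ hz
    omega
  refine ⟨F, ⟨Finset.subset_univ _, ⟨⟨x.1, (mem_fCopy.1 hxF).1⟩, ?_⟩, ?_⟩, h2, hFm⟩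
  · intro P hP hPc heq
    obtain ⟨p, hp, q, hq, hpq⟩ := Finset.one_lt_card.1 hPc
    obtain ⟨e, he⟩ := hP.1 p hp
    obtain ⟨e', he'⟩ := hP.1 q hq
    obtain ⟨y, rfl, hy⟩ := fCopy_exists (R := R) hD hπ e
    obtain ⟨z, rfl, hz⟩ := fCopy_exists (R := R) hD hπ e'
    obtain ⟨C, hC, hc, hyC, hzC⟩ := hconn y (mem_fCopy.2 ⟨part_sub hP hp he, hy⟩) z
      (mem_fCopy.2 ⟨part_sub hP hq he', hz⟩)
    obtain ⟨r, hr, hCr⟩ := circ_of_sep hD hπ hP heq hC hc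
    have h3 := part_disj hP hp hr he (mem_fCopy.1 (hCr hyC)).1
    have h4 := part_disj hP hq hr he' (mem_fCopy.1 (hCr hzC)).1
    exact hpq (h3.trans h4.symm)
  · intro F' _ hF' hs
    refine Finset.Subset.antisymm (fCopy_subset (R := R) hD hπ fun y hy => ?_) hs
    have := partII hD hπ hF' (h2.trans (Finset.card_le_card hs)) x (fCopy_mono hs hxF) y hy
    exact (hFm y).2 (this.mono (fCopy_mono (Finset.subset_univ _)))

theorem PConn_fHat [Fintype E] (hD : 3 ≤ D) (hπ : ∀ e, ¬ (π e).IsDiag) {F : Finset E}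
    (hF : PConn D π R F) : fHat D π R F = fCnt D π R F := by
  obtain ⟨P, hP, h⟩ := fHat_attain (D := D) (π := π) (R := R) F
  by_cases hc : 2 ≤ P.card
  · exfalso
    refine hF.2 P hP hc ((fHat_subadd hD hπ hP).antisymm ?_)
    rw [h]
    refine Finset.sum_le_sum fun p hp => ?_
    simpa using fHat_le (D := D) (π := π) (R := R) (part_single (hP.1 p hp))
  · obtain ⟨e, he⟩ := hF.1
    obtain ⟨p, hp, hep⟩ := (part_mem hP).1 he
    have : P = {p} := by
      rw [Finset.eq_singleton_iff_unique_mem]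
      exact ⟨hp, fun q hq => Finset.card_le_one.1 (by omega) _ hq _ hp⟩
    subst this
    have h2 := hP.2.2
    simp at h2
    rw [h, Finset.sum_singleton, h2]

end FinalCount

theorem statement_16
    (V E : Type) [Fintype V] [Fintype E] [DecidableEq V] [DecidableEq E]
    (π : E → Sym2 V) (hπ : ∀ e : E, ¬ (π e).IsDiag)
    (B R : Finset V) (hdisj : Disjoint B R) (hcov : B ∪ R = Finset.univ)
    (d D : ℕ) (hd : 3 ≤ d) (hD : D = (d + 1).choose 2) :
    (∀ X : Finset (E × Fin D),
      MConnComp D (fun x : E × Fin D => π x.1) R (fCopy D π R Finset.univ) X →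
      2 ≤ X.card →
      ∃ F : Finset E, PConnComp D π R Finset.univ F ∧ 2 ≤ F.card ∧ X = fCopy D π R F) ∧
    (∀ F : Finset E, PConn D π R F → 2 ≤ F.card →
      MConn D (fun x : E × Fin D => π x.1) R (fCopy D π R F)) ∧
    (∀ P : Finset (Finset E), IsPartitionOf Finset.univ P →
      (∀ p ∈ P, PConnComp D π R Finset.univ p) →
      fHat D π R Finset.univ = ∑ p ∈ P, fCnt D π R p) := by
  
  have hD3 : 3 ≤ D := by
    have h1 := Nat.choose_le_choose 2 (show 4 ≤ d + 1 by omega)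
    have h2 : Nat.choose 4 2 = 6 := by decide
    omega
  have hii : ∀ F : Finset E, PConn D π R F → 2 ≤ F.card →
      MConn D (fun x : E × Fin D => π x.1) R (fCopy D π R F) := by
    intro F hF h2
    exact Or.inr (partII hD3 hπ hF h2)
  refine ⟨?_, hii, ?_⟩
  · intro X hX h2
    have hrel : ∀ x ∈ X, ∀ y ∈ X, CRel D π R X x y := by
      rcases hX.2.1 with h | h
      · omega
      · exact h
    obtain ⟨x, hx⟩ := Finset.card_pos.1 (by omega : 0 < X.card)
    obtain ⟨F, hF, hF2, hm⟩ := compK hD3 hπ ((hrel x hx x hx).mono hX.1)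
    refine ⟨F, hF, hF2, (hX.2.2 _ (fCopy_mono (Finset.subset_univ _)) (hii F hF.2.1 hF2) ?_).symm⟩
    exact fun y hy => (hm y).2 ((hrel x hx y hy).mono hX.1)
  · intro P hP hcomp
    rw [← Finset.sum_congr rfl fun p hp => PConn_fHat hD3 hπ (hcomp p hp).2.1]
    refine sep_of_circ hD3 hπ hP fun C hC hc => ?_
    have hne : C.Nonempty := by
      rw [Finset.nonempty_iff_ne_empty]
      rintro rfl
      exact hc.1 AInd_empty
    obtain ⟨x, hx⟩ := hne
    obtain ⟨F, hF, hF2, hm⟩ := compK hD3 hπ (x := x) ⟨C, hC, hc, hx, hx⟩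
    have hCF : C ⊆ fCopy D π R F := fun y hy => (hm y).2 ⟨C, hC, hc, hx, hy⟩
    have hxF := hCF hx
    obtain ⟨p, hp, hxp⟩ := (part_mem hP).1 (Finset.mem_univ x.1)
    have hpF : p ⊆ F := by
      by_cases h2 : 2 ≤ p.card
      · refine fCopy_subset (R := R) hD3 hπ fun y hy => (hm y).2 ?_
        exact (partII hD3 hπ (hcomp p hp).2.1 h2 x
          (mem_fCopy.2 ⟨hxp, (mem_fCopy.1 hxF).2⟩) y hy).mono (fCopy_mono (Finset.subset_univ _))
      · intro e he
        rw [Finset.card_le_one.1 (by omega) e he x.1 hxp]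
        exact (mem_fCopy.1 hxF).1
    have := (hcomp p hp).2.2 F (Finset.subset_univ _) hF.2.1 hpF
    exact ⟨p, hp, this ▸ hCF⟩
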